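/- Let X and Y be uniform spaces, let (μₙ) be a sequence of uniform measures on X and (νₙ) a sequence of uniform measures on Y, and let μ, ν be uniform measures on X and Y respectively. Suppose μₙ(g) → μ(g) for every g ∈ Ub(X) and νₙ(h) → ν(h) for every h ∈ Ub(Y). Then (μₙ ⊗ νₙ)(f) → (μ ⊗ ν)(f) for every semiuniform f : X × Y → ℝ. (That is, the direct product is jointly sequentially continuous on uniform measures for the weak-* topologies.) -/

import Mathlib

noncomputable section

open Filter Topology

/-- `f` is a bounded uniformly continuous real-valued function,
i.e. a member of `Ub(X)`. -/
def IsUb {X : Type*} [UniformSpace X] (f : X → ℝ) : Prop :=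
  UniformContinuous f ∧ ∃ C : ℝ, ∀ x, |f x| ≤ C

/-- Supremum norm of a real-valued function. -/
def supNorm {α : Type*} (f : α → ℝ) : ℝ :=
  sSup (Set.range fun x => |f x|)

/-- `μ` is (the restriction to `Ub(X)` of) a norm-continuous linear functional on `Ub(X)`,
i.e. a member of `Meas(X)`.  It is represented as a bare map on all functions;
only its values on `Ub(X)` are relevant. -/
def IsMeas {X : Type*} [UniformSpace X] (μ : (X → ℝ) → ℝ) : Prop :=
  (∀ f g : X → ℝ, IsUb f → IsUb g → μ (f + g) = μ f + μ g) ∧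
  (∀ (c : ℝ) (f : X → ℝ), IsUb f → μ (c • f) = c * μ f) ∧
  (∃ C : ℝ, ∀ f : X → ℝ, IsUb f → (∀ x, |f x| ≤ 1) → |μ f| ≤ C)

/-- The dual norm on `Meas(X)`:  `‖μ‖ = sup {|μ f| : f ∈ Ub(X), ‖f‖ ≤ 1}`. -/
def measNorm {X : Type*} [UniformSpace X] (μ : (X → ℝ) → ℝ) : ℝ :=
  sSup {r : ℝ | ∃ f : X → ℝ, IsUb f ∧ (∀ x, |f x| ≤ 1) ∧ r = |μ f|}

/-- `μ` is a positive functional:  `μ f ≥ 0` whenever `f ∈ Ub(X)` and `f ≥ 0`. -/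
def IsPositive {X : Type*} [UniformSpace X] (μ : (X → ℝ) → ℝ) : Prop :=
  ∀ f : X → ℝ, IsUb f → (∀ x, 0 ≤ f x) → 0 ≤ μ f

/-- `μ` is a *uniform measure*: on every norm-bounded uniformly equicontinuous set
`H ⊆ Ub(X)`, `μ` is continuous for the topology of pointwise convergence. -/
def IsUniformMeasure {X : Type*} [UniformSpace X] (μ : (X → ℝ) → ℝ) : Prop :=
  ∀ H : Set (X → ℝ),
    (∃ C : ℝ, ∀ f ∈ H, ∀ x, |f x| ≤ C) →
    H.UniformEquicontinuous →
    ∀ f₀ ∈ H, ∀ ε : ℝ, 0 < ε →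
      ∃ (K : Finset X) (δ : ℝ), 0 < δ ∧
        ∀ f ∈ H, (∀ x ∈ K, |f x - f₀ x| < δ) → |μ f - μ f₀| < ε

/-- A *semiuniform* function on `X × Y`, i.e. a member of `Ub(X ⋉ Y)` where `X ⋉ Y` is the
semiuniform product: `f` is bounded, the family of sections `x ↦ f (x, y)` (for `y ∈ Y`)
is uniformly equicontinuous on `X`, and every section `y ↦ f (x, y)` is uniformly
continuous on `Y`. -/
def Semiuniform {X Y : Type*} [UniformSpace X] [UniformSpace Y] (f : X × Y → ℝ) : Prop :=
  (∃ C : ℝ, ∀ p, |f p| ≤ C) ∧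
  UniformEquicontinuous (fun y : Y => fun x : X => f (x, y)) ∧
  ∀ x : X, UniformContinuous fun y : Y => f (x, y)

/-- The direct product `μ ⊗ ν`, evaluated at `f : X × Y → ℝ`:
`(μ ⊗ ν)(f) = μ (x ↦ ν (y ↦ f (x, y)))`. -/
def dirProd {X Y : Type*} (μ : (X → ℝ) → ℝ) (ν : (Y → ℝ) → ℝ) (f : X × Y → ℝ) : ℝ :=
  μ fun x => ν fun y => f (x, y)

/-- Convolution: `(μ ⋆ ν)(f) = μ (x ↦ ν (y ↦ f (x · y)))`. -/
def conv {G : Type*} [Mul G] (μ ν : (G → ℝ) → ℝ) : (G → ℝ) → ℝ :=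
  fun f => μ fun x => ν fun y => f (x * y)

/-- The weak-* topology on `Meas(X)`: the topology of pointwise convergence on `Ub(X)`. -/
def weakStarMeas (X : Type*) [UniformSpace X] :
    TopologicalSpace {ν : (X → ℝ) → ℝ // IsMeas ν} :=
  TopologicalSpace.induced
    (fun ν => fun f : {f : X → ℝ // IsUb f} => ν.1 f.1) Pi.topologicalSpace

open scoped Uniformity

section UniformMeasureLemmas

variable {X : Type*} [UniformSpace X]

lemma uniformEquicontinuous_real_iff {ι : Type*} {F : ι → X → ℝ} :
    UniformEquicontinuous F ↔
      ∀ ε > 0, ∀ᶠ p in 𝓤 X, ∀ i, |F i p.1 - F i p.2| < ε := by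
  rw [Metric.uniformEquicontinuous_iff_right]
  simp only [Real.dist_eq]

lemma UniformEquicontinuous.comp_real {ι : Type*} {F : ι → X → ℝ} (hF : UniformEquicontinuous F)
    {φ : ℝ → ℝ} (hφ : ∀ a b, |φ a - φ b| ≤ |a - b|) :
    UniformEquicontinuous fun i x => φ (F i x) := by
  rw [uniformEquicontinuous_real_iff] at hF ⊢
  intro ε hε
  filter_upwards [hF ε hε] with p hp i
  exact (hφ _ _).trans_lt (hp i)

namespace IsMeas

variable {μ : (X → ℝ) → ℝ}

lemma map_zero (hμ : IsMeas μ) : μ 0 = 0 := by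
  have h := hμ.2.1 0 0 ⟨uniformContinuous_const, 0, by simp⟩
  simpa using h

lemma map_sub (hμ : IsMeas μ) {f g : X → ℝ} (hg : IsUb g) (hfg : IsUb (f - g)) :
    μ (f - g) = μ f - μ g := by
  have h := hμ.1 (f - g) g hfg hg
  rw [sub_add_cancel] at h
  linarith

lemma sub {ν : (X → ℝ) → ℝ} (hμ : IsMeas μ) (hν : IsMeas ν) : IsMeas fun f => μ f - ν f := by
  obtain ⟨ha, hs, C, hC⟩ := hμ
  obtain ⟨ha', hs', C', hC'⟩ := hν
  refine ⟨fun f g hf hg => ?_, fun c f hf => ?_, C + C', fun f hf h1 => ?_⟩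
  · simp only [ha f g hf hg, ha' f g hf hg]; ring
  · simp only [hs c f hf, hs' c f hf]; ring
  · exact (abs_sub _ _).trans (add_le_add (hC f hf h1) (hC' f hf h1))

end IsMeas

lemma IsUb.sub {f g : X → ℝ} (hf : IsUb f) (hg : IsUb g) : IsUb (f - g) := by
  obtain ⟨hf, C, hC⟩ := hf
  obtain ⟨hg, D, hD⟩ := hg
  exact ⟨hf.sub hg, C + D, fun x => (abs_sub _ _).trans (add_le_add (hC x) (hD x))⟩

/-- The bounded uniformly continuous functions, as a subspace of the bounded continuous ones. -/
def ubSubmodule (X : Type*) [UniformSpace X] : Submodule ℝ (BoundedContinuousFunction X ℝ) where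
  carrier := {f | UniformContinuous f}
  add_mem' hf hg := UniformContinuous.add hf hg
  zero_mem' := uniformContinuous_const
  smul_mem' c _ hf := UniformContinuous.const_smul hf c

lemma isClosed_ubSubmodule : IsClosed (ubSubmodule X : Set (BoundedContinuousFunction X ℝ)) := by
  refine isClosed_of_closure_subset fun f hf => ?_
  obtain ⟨u, hu, huf⟩ := mem_closure_iff_seq_limit.1 hf
  exact (BoundedContinuousFunction.tendsto_iff_tendstoUniformly.1 huf).uniformContinuous
    (Frequently.of_forall hu)

/-- The Banach space of bounded uniformly continuous functions. -/
def UbSpace (X : Type*) [UniformSpace X] : Type _ := ubSubmodule X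

instance : NormedAddCommGroup (UbSpace X) := inferInstanceAs (NormedAddCommGroup (ubSubmodule X))

instance : NormedSpace ℝ (UbSpace X) := inferInstanceAs (NormedSpace ℝ (ubSubmodule X))

instance : CompleteSpace (UbSpace X) :=
  (isClosed_ubSubmodule (X := X)).completeSpace_coe

lemma isUb_coe_ubSpace (f : UbSpace X) : IsUb f.1 :=
  ⟨f.2, ‖f.1‖, fun x => f.1.norm_coe_le_norm x⟩

lemma IsMeas.exists_bound {μ : (X → ℝ) → ℝ} (hμ : IsMeas μ) :
    ∃ C, ∀ (f : X → ℝ) (r : ℝ), 0 < r → IsUb f → (∀ x, |f x| ≤ r) → |μ f| ≤ C * r := by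
  obtain ⟨-, hs, C, hC⟩ := hμ
  refine ⟨C, fun f r hr hf hfr => ?_⟩
  have h1 : IsUb (r⁻¹ • f) := by
    refine ⟨hf.1.const_smul _, 1, fun x => ?_⟩
    rw [Pi.smul_apply, smul_eq_mul, abs_mul, abs_inv, abs_of_pos hr, inv_mul_le_iff₀ hr, mul_one]
    exact hfr x
  have h2 := hC _ h1 fun x => by
    rw [Pi.smul_apply, smul_eq_mul, abs_mul, abs_inv, abs_of_pos hr, inv_mul_le_iff₀ hr, mul_one]
    exact hfr x
  rw [hs _ _ hf, abs_mul, abs_inv, abs_of_pos hr, inv_mul_le_iff₀ hr] at h2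
  linarith

/-- Banach–Steinhaus for sequences in `Meas(X)`. -/
lemma exists_uniform_bound_of_tendsto {σ : ℕ → (X → ℝ) → ℝ} {τ : (X → ℝ) → ℝ}
    (hσ : ∀ n, IsMeas (σ n))
    (hlim : ∀ g, IsUb g → Tendsto (fun n => σ n g) atTop (𝓝 (τ g))) :
    ∃ C, 0 ≤ C ∧ ∀ (n : ℕ) (f : X → ℝ) (r : ℝ), 0 < r → IsUb f → (∀ x, |f x| ≤ r) →
      |σ n f| ≤ C * r := by
  let L : ℕ → UbSpace X →ₗ[ℝ] ℝ := fun n =>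
    { toFun := fun f => σ n f.1
      map_add' := fun f g => (hσ n).1 _ _ (isUb_coe_ubSpace f) (isUb_coe_ubSpace g)
      map_smul' := fun c f => (hσ n).2.1 c _ (isUb_coe_ubSpace f) }
  have hL : ∀ n, ∃ C : ℝ, ∀ f, ‖L n f‖ ≤ C * ‖f‖ := by
    intro n
    obtain ⟨C, hC⟩ := (hσ n).exists_bound
    refine ⟨C, fun f => ?_⟩
    rcases eq_or_ne f 0 with rfl | hf
    · simp
    · have hf0 : 0 < ‖f‖ := norm_pos_iff.2 hf
      exact hC _ _ hf0 (isUb_coe_ubSpace f) fun x => f.1.norm_coe_le_norm x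
  let T : ℕ → UbSpace X →L[ℝ] ℝ := fun n => (L n).mkContinuousOfExistsBound (hL n)
  obtain ⟨C, hC⟩ : ∃ C, ∀ n, ‖T n‖ ≤ C := banach_steinhaus (by
    intro f
    obtain ⟨C, hC⟩ := (hlim _ (isUb_coe_ubSpace f)).abs.bddAbove_range
    exact ⟨C, fun n => hC ⟨n, rfl⟩⟩)
  have hC0 : 0 ≤ C := (norm_nonneg _).trans (hC 0)
  refine ⟨C, hC0, fun n f r hr hf hfr => ?_⟩
  let F : BoundedContinuousFunction X ℝ :=
    BoundedContinuousFunction.ofNormedAddCommGroup f hf.1.continuous r hfr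
  have hF : ‖F‖ ≤ r :=
    BoundedContinuousFunction.norm_ofNormedAddCommGroup_le hf.1.continuous hr.le hfr
  have h := (T n).le_of_opNorm_le (hC n) ⟨F, hf.1⟩
  exact h.trans (mul_le_mul_of_nonneg_left hF hC0)

lemma IsUniformMeasure.continuousOn {μ : (X → ℝ) → ℝ} (hμ : IsUniformMeasure μ)
    {H : Set (X → ℝ)} (hb : ∃ C : ℝ, ∀ f ∈ H, ∀ x, |f x| ≤ C) (he : H.UniformEquicontinuous) :
    ContinuousOn μ H := by
  intro f₀ hf₀
  rw [ContinuousWithinAt, Metric.tendsto_nhds]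
  intro ε hε
  obtain ⟨K, δ, hδ, hK⟩ := hμ H hb he f₀ hf₀ ε hε
  have h : ∀ᶠ f : X → ℝ in 𝓝 f₀, ∀ x ∈ K, |f x - f₀ x| < δ := by
    rw [Filter.eventually_all_finset]
    intro x _
    exact (continuous_apply x).continuousAt.eventually (Metric.ball_mem_nhds (f₀ x) hδ)
  filter_upwards [mem_nhdsWithin_of_mem_nhds h, self_mem_nhdsWithin] with f hf hfH
  exact hK f hfH hf

/-- Functions with values in `[0, B]` that are `M`-Lipschitz for the pseudometric
`(x, x') ↦ sup_k |h k x - h k x'|`. -/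
def lipSet {X : Type*} (h : ℕ → X → ℝ) (B M : ℝ) : Set (X → ℝ) :=
  {g | (∀ x, g x ∈ Set.Icc 0 B) ∧
    ∀ x x' r, (∀ k, |h k x - h k x'| ≤ r) → |g x - g x'| ≤ M * r}

lemma isCompact_lipSet {X : Type*} (h : ℕ → X → ℝ) (B M : ℝ) : IsCompact (lipSet h B M) := by
  refine (isCompact_univ_pi fun _ : X => isCompact_Icc (a := (0 : ℝ)) (b := B)).of_isClosed_subset
    ?_ fun g hg x _ => hg.1 x
  simp only [lipSet, Set.ofPred_and, Set.ofPred_forall]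
  refine (isClosed_iInter fun x => isClosed_Icc.preimage (continuous_apply x)).inter
    (isClosed_iInter fun x => isClosed_iInter fun x' => isClosed_iInter fun r =>
      isClosed_iInter fun _ => isClosed_le ?_ continuous_const)
  fun_prop

lemma uniformEquicontinuous_lipSet {h : ℕ → X → ℝ} (he : UniformEquicontinuous h) (B : ℝ) {M : ℝ}
    (hM : 0 < M) : (lipSet h B M).UniformEquicontinuous := by
  rw [Set.UniformEquicontinuous, uniformEquicontinuous_real_iff]
  rw [uniformEquicontinuous_real_iff] at he
  intro ε hε
  filter_upwards [he (ε / (2 * M)) (by positivity)] with p hp g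
  have := g.2.2 p.1 p.2 _ fun k => (hp k).le
  have h2 : M * (ε / (2 * M)) = ε / 2 := by field_simp
  change |g.1 p.1 - g.1 p.2| < ε
  linarith

lemma abs_le_of_mem_lipSet {X : Type*} {h : ℕ → X → ℝ} {B M : ℝ} {g : X → ℝ}
    (hg : g ∈ lipSet h B M) (x : X) : |g x| ≤ B := by
  rw [abs_of_nonneg (hg.1 x).1]
  exact (hg.1 x).2

lemma isUb_of_mem_lipSet {h : ℕ → X → ℝ} (he : UniformEquicontinuous h) {B M : ℝ}
    (hM : 0 < M) {g : X → ℝ} (hg : g ∈ lipSet h B M) : IsUb g :=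
  ⟨(uniformEquicontinuous_lipSet he B hM).uniformContinuous ⟨g, hg⟩, B, abs_le_of_mem_lipSet hg⟩

lemma sup_mem_lipSet {X : Type*} {h : ℕ → X → ℝ} {B M : ℝ} {f g : X → ℝ}
    (hf : f ∈ lipSet h B M) (hg : g ∈ lipSet h B M) :
    (fun x => max (f x) (g x)) ∈ lipSet h B M :=
  ⟨fun x => ⟨le_max_of_le_left (hf.1 x).1, max_le (hf.1 x).2 (hg.1 x).2⟩,
    fun x x' r hr => (abs_max_sub_max_le_max _ _ _ _).trans
      (max_le (hf.2 x x' r hr) (hg.2 x x' r hr))⟩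

lemma inf_mem_lipSet {X : Type*} {h : ℕ → X → ℝ} {B M : ℝ} {f g : X → ℝ}
    (hf : f ∈ lipSet h B M) (hg : g ∈ lipSet h B M) :
    (fun x => min (f x) (g x)) ∈ lipSet h B M :=
  ⟨fun x => ⟨le_min (hf.1 x).1 (hg.1 x).1, min_le_of_left_le (hf.1 x).2⟩,
    fun x x' r hr => (abs_min_sub_min_le_max _ _ _ _).trans
      (max_le (hf.2 x x' r hr) (hg.2 x x' r hr))⟩

lemma comp_mem_lipSet {X : Type*} {h : ℕ → X → ℝ} {B M : ℝ} (hM : 0 ≤ M)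
    (hB : ∀ n x, h n x ∈ Set.Icc 0 B)
    {φ : ℝ → ℝ} (hφ : ∀ t ∈ Set.Icc 0 B, φ t ∈ Set.Icc 0 B)
    (hφM : ∀ a b, |φ a - φ b| ≤ M * |a - b|) (n : ℕ) :
    (fun x => φ (h n x)) ∈ lipSet h B M :=
  ⟨fun x => hφ _ (hB n x), fun _ _ _ hr =>
    (hφM _ _).trans (mul_le_mul_of_nonneg_left (hr n) hM)⟩

/-- A Baire category argument in the compact space `lipSet h B M`. -/
lemma exists_eventually_small {σ : ℕ → (X → ℝ) → ℝ}
    (hc : ∀ n (H : Set (X → ℝ)), (∃ C : ℝ, ∀ f ∈ H, ∀ x, |f x| ≤ C) →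
      H.UniformEquicontinuous → ContinuousOn (σ n) H)
    (hlim : ∀ g, IsUb g → Tendsto (fun n => σ n g) atTop (𝓝 0))
    {h : ℕ → X → ℝ} (he : UniformEquicontinuous h) {B M : ℝ} (hB : 0 ≤ B) (hM : 0 < M)
    {ε : ℝ} (hε : 0 < ε) :
    ∃ g₀ ∈ lipSet h B M, ∃ N : ℕ, ∀ u : ℕ → X → ℝ, (∀ n, u n ∈ lipSet h B M) →
      (∀ x, Tendsto (fun n => u n x) atTop (𝓝 (g₀ x))) →
      ∀ᶠ k in atTop, ∀ n ≥ N, |σ n (u k)| ≤ ε := by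
  have : CompactSpace (lipSet h B M) := isCompact_iff_compactSpace.1 (isCompact_lipSet h B M)
  have : Nonempty (lipSet h B M) := by
    refine ⟨0, fun x => ⟨le_rfl, hB⟩, fun x x' r hr => ?_⟩
    simpa using mul_nonneg hM.le ((abs_nonneg _).trans (hr 0))
  have hcont : ∀ n, Continuous fun g : lipSet h B M => σ n g.1 := fun n =>
    continuousOn_iff_continuous_domRestrict.1
      (hc n _ ⟨B, fun f hf => abs_le_of_mem_lipSet hf⟩ (uniformEquicontinuous_lipSet he B hM))
  obtain ⟨N, g₀, hg₀⟩ := nonempty_interior_of_iUnion_of_closed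
    (f := fun N : ℕ => {g : lipSet h B M | ∀ n ≥ N, |σ n g.1| ≤ ε}) (by
      intro N
      simp only [Set.ofPred_forall]
      exact isClosed_iInter fun n => isClosed_iInter fun _ =>
        isClosed_le (hcont n).abs continuous_const) (by
      refine Set.eq_univ_of_forall fun g => ?_
      have h1 := (hlim _ (isUb_of_mem_lipSet he hM g.2)).abs
      rw [abs_zero] at h1
      obtain ⟨N, hN⟩ := eventually_atTop.1 (h1.eventually (ge_mem_nhds hε))
      exact Set.mem_iUnion.2 ⟨N, hN⟩)
  refine ⟨g₀.1, g₀.2, N, fun u hu hlim => ?_⟩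
  have hu' : Tendsto (fun k => (⟨u k, hu k⟩ : lipSet h B M)) atTop (𝓝 g₀) :=
    tendsto_subtype_rng.2 (tendsto_pi_nhds.2 hlim)
  exact hu'.eventually (mem_interior_iff_mem_nhds.1 hg₀)

lemma tendsto_diag_of_nonneg {σ : ℕ → (X → ℝ) → ℝ} (hσ : ∀ n, IsMeas (σ n))
    (hc : ∀ n (H : Set (X → ℝ)), (∃ C : ℝ, ∀ f ∈ H, ∀ x, |f x| ≤ C) →
      H.UniformEquicontinuous → ContinuousOn (σ n) H)
    (hlim : ∀ g, IsUb g → Tendsto (fun n => σ n g) atTop (𝓝 0))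
    {h : ℕ → X → ℝ} (he : UniformEquicontinuous h) {B : ℝ} (hB : 0 ≤ B)
    (hhB : ∀ n x, h n x ∈ Set.Icc 0 B)
    (hh : ∀ x, Tendsto (fun n => h n x) atTop (𝓝 0)) :
    Tendsto (fun n => σ n (h n)) atTop (𝓝 0) := by
  obtain ⟨C, hC0, hC⟩ := exists_uniform_bound_of_tendsto (τ := fun _ => 0) hσ hlim
  rw [Metric.tendsto_nhds]
  intro ε hε
  obtain ⟨δ, hδ, hCδ⟩ : ∃ δ > 0, C * (2 * δ) ≤ ε / 4 :=
    ⟨ε / (8 * (C + 1)), by positivity, by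
      rw [← sub_nonneg]
      have : ε / 4 - C * (2 * (ε / (8 * (C + 1)))) = ε / (4 * (C + 1)) := by field_simp; ring
      rw [this]; positivity⟩
  set M : ℝ := B / δ + 1 with hM
  have hBδ : 0 ≤ B / δ := by positivity
  have hM0 : 0 < M := by positivity
  have hMδ : B ≤ M * δ := by
    have : M * δ = B + δ := by rw [hM]; field_simp
    linarith
  obtain ⟨g₀, hg₀, N, hN⟩ := exists_eventually_small hc hlim he hB hM0 (ε := ε / 4) (by positivity)
  have hmax : ∀ a b : ℝ, |max 0 a - max 0 b| ≤ |a - b| := fun a b => by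
    simpa only [max_comm] using abs_max_sub_max_le_abs a b 0
  have hψ := comp_mem_lipSet hM0.le hhB (φ := fun t => max 0 (B - M * max 0 (t - δ)))
    (fun t _ => ⟨le_max_left _ _, max_le hB (by
      have := mul_nonneg hM0.le (le_max_left 0 (t - δ)); linarith)⟩)
    (fun a b => by
      have h1 := hmax (B - M * max 0 (a - δ)) (B - M * max 0 (b - δ))
      have h2 := hmax (b - δ) (a - δ)
      have e1 : B - M * max 0 (a - δ) - (B - M * max 0 (b - δ)) =
        M * (max 0 (b - δ) - max 0 (a - δ)) := by ring
      rw [e1, abs_mul, abs_of_pos hM0] at h1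
      rw [sub_sub_sub_cancel_right, abs_sub_comm b a] at h2
      exact h1.trans (mul_le_mul_of_nonneg_left h2 hM0.le))
  have hcut := comp_mem_lipSet hM0.le hhB (φ := fun t => max 0 (t - 2 * δ))
    (fun t ht => ⟨le_max_left _ _, max_le hB (by linarith [ht.2])⟩)
    (fun a b => by
      have h2 := hmax (a - 2 * δ) (b - 2 * δ)
      rw [sub_sub_sub_cancel_right] at h2
      nlinarith [abs_nonneg (a - b)])
  have hid := comp_mem_lipSet hM0.le hhB (φ := fun t => t) (fun _ ht => ht)
    (fun a b => by nlinarith [abs_nonneg (a - b)])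
  have hv := fun n => inf_mem_lipSet hg₀ (hψ n)
  have hu := fun n => sup_mem_lipSet (hv n) (hcut n)
  have hsmall : ∀ x, ∀ᶠ n in atTop, h n x < δ := fun x => (hh x).eventually (gt_mem_nhds hδ)
  have hvsm := hN _ hv fun x => tendsto_const_nhds.congr' (by
    filter_upwards [hsmall x] with n hn
    rw [max_eq_left (by linarith : h n x - δ ≤ 0), mul_zero, sub_zero, max_eq_right hB,
      min_eq_left (hg₀.1 x).2])
  have husm := hN _ hu fun x => tendsto_const_nhds.congr' (by
    filter_upwards [hsmall x] with n hn
    rw [max_eq_left (by linarith : h n x - δ ≤ 0), mul_zero, sub_zero, max_eq_right hB,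
      min_eq_left (hg₀.1 x).2, max_eq_left (by linarith : h n x - 2 * δ ≤ 0),
      max_eq_left (hg₀.1 x).1])
  filter_upwards [hvsm, husm, eventually_ge_atTop N] with n hvn hun hnN
  have hub := fun {g : X → ℝ} (hg : g ∈ lipSet h B M) => isUb_of_mem_lipSet he hM0 hg
  have hsplit := (hσ n).1 _ _ (hub (hv n)) (hub (hcut n))
  have hsum : (fun x => min (g₀ x) (max 0 (B - M * max 0 (h n x - δ)))) +
      (fun x => max 0 (h n x - 2 * δ)) =
      fun x => max (min (g₀ x) (max 0 (B - M * max 0 (h n x - δ)))) (max 0 (h n x - 2 * δ)) := by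
    funext x
    rw [Pi.add_apply]
    rcases le_total (h n x) (2 * δ) with hx | hx
    · rw [max_eq_left (by linarith : h n x - 2 * δ ≤ 0), add_zero]
      exact (max_eq_left (le_min (hg₀.1 x).1 (le_max_left _ _))).symm
    · have h1 : B - M * max 0 (h n x - δ) ≤ 0 := by
        have : δ ≤ max 0 (h n x - δ) := le_max_of_le_right (by linarith)
        have := mul_le_mul_of_nonneg_left this hM0.le
        linarith
      rw [max_eq_left h1, min_eq_right (hg₀.1 x).1, zero_add, max_eq_right (le_max_left _ _)]
  rw [hsum] at hsplit
  have hdiff := (hσ n).map_sub (hub (hcut n)) ((hub (hid n)).sub (hub (hcut n)))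
  have hbd := hC n _ (2 * δ) (by positivity) ((hub (hid n)).sub (hub (hcut n))) (by
    intro x
    have := (hhB n x).1
    rw [Pi.sub_apply, abs_le]
    rcases le_total (h n x) (2 * δ) with hx | hx
    · rw [max_eq_left (by linarith : h n x - 2 * δ ≤ 0)]
      constructor <;> linarith
    · rw [max_eq_right (by linarith : 0 ≤ h n x - 2 * δ)]
      constructor <;> linarith)
  rw [hdiff] at hbd
  have h1 := abs_le.1 (hbd.trans hCδ)
  have h2 := abs_le.1 (hvn n hnN)
  have h3 := abs_le.1 (hun n hnN)
  rw [Real.dist_eq, sub_zero, abs_lt]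
  constructor <;> linarith [h1.1, h1.2, h2.1, h2.2, h3.1, h3.2]

/-- A weak-* null sequence in `Meas(X)` of functionals continuous on bounded uniformly
equicontinuous sets is jointly null along pointwise null sequences in such sets. -/
lemma tendsto_diag {σ : ℕ → (X → ℝ) → ℝ} (hσ : ∀ n, IsMeas (σ n))
    (hc : ∀ n (H : Set (X → ℝ)), (∃ C : ℝ, ∀ f ∈ H, ∀ x, |f x| ≤ C) →
      H.UniformEquicontinuous → ContinuousOn (σ n) H)
    (hlim : ∀ g, IsUb g → Tendsto (fun n => σ n g) atTop (𝓝 0))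
    {h : ℕ → X → ℝ} (he : UniformEquicontinuous h) {B : ℝ} (hB : 0 ≤ B)
    (hhB : ∀ n x, |h n x| ≤ B)
    (hh : ∀ x, Tendsto (fun n => h n x) atTop (𝓝 0)) :
    Tendsto (fun n => σ n (h n)) atTop (𝓝 0) := by
  have hpos : ∀ a b : ℝ, |max a 0 - max b 0| ≤ |a - b| := fun a b => abs_max_sub_max_le_abs a b 0
  have hneg : ∀ a b : ℝ, |max (-a) 0 - max (-b) 0| ≤ |a - b| := fun a b =>
    (abs_max_sub_max_le_abs (-a) (-b) 0).trans (by rw [neg_sub_neg, abs_sub_comm])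
  have ep := he.comp_real (φ := fun a => max a 0) hpos
  have en := he.comp_real (φ := fun a => max (-a) 0) hneg
  have bp : ∀ n x, max (h n x) 0 ∈ Set.Icc 0 B := fun n x =>
    ⟨le_max_right _ _, max_le (abs_le.1 (hhB n x)).2 hB⟩
  have bn : ∀ n x, max (-h n x) 0 ∈ Set.Icc 0 B := fun n x =>
    ⟨le_max_right _ _, max_le (by linarith [(abs_le.1 (hhB n x)).1]) hB⟩
  have tp := tendsto_diag_of_nonneg hσ hc hlim ep hB bp fun x => by
    simpa using (hh x).max (tendsto_const_nhds (x := (0 : ℝ)))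
  have tn := tendsto_diag_of_nonneg hσ hc hlim en hB bn fun x => by
    simpa using (hh x).neg.max (tendsto_const_nhds (x := (0 : ℝ)))
  rw [← sub_zero (0 : ℝ)]
  refine (tp.sub tn).congr fun n => ?_
  have ubp : IsUb fun x => max (h n x) 0 :=
    ⟨ep.uniformContinuous n, B, fun x => by rw [abs_of_nonneg (bp n x).1]; exact (bp n x).2⟩
  have ubn : IsUb fun x => max (-h n x) 0 :=
    ⟨en.uniformContinuous n, B, fun x => by rw [abs_of_nonneg (bn n x).1]; exact (bn n x).2⟩
  rw [← (hσ n).map_sub ubn (ubp.sub ubn)]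
  congr 1
  funext x
  rw [Pi.sub_apply]
  rcases le_total (h n x) 0 with hx | hx
  · rw [max_eq_right hx, max_eq_left (by linarith)]; ring
  · rw [max_eq_left hx, max_eq_right (by linarith)]; ring

lemma IsUniformMeasure.tendsto_zero {μ : (X → ℝ) → ℝ} (hμ : IsMeas μ) (hμu : IsUniformMeasure μ)
    {h : ℕ → X → ℝ} (he : UniformEquicontinuous h) {B : ℝ} (hB : 0 ≤ B) (hhB : ∀ n x, |h n x| ≤ B)
    (hh : ∀ x, Tendsto (fun n => h n x) atTop (𝓝 0)) :
    Tendsto (fun n => μ (h n)) atTop (𝓝 0) := by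
  have hcont : ContinuousOn μ (insert 0 (Set.range h)) := by
    refine hμu.continuousOn ⟨B, ?_⟩ ?_
    · rintro f (rfl | ⟨n, rfl⟩) x
      · simpa using hB
      · exact hhB n x
    · rw [Set.UniformEquicontinuous, uniformEquicontinuous_real_iff]
      rw [uniformEquicontinuous_real_iff] at he
      intro ε hε
      filter_upwards [he ε hε] with p hp
      rintro ⟨f, rfl | ⟨n, rfl⟩⟩
      · simpa using hε
      · exact hp n
  have ht : Tendsto h atTop (𝓝[insert 0 (Set.range h)] 0) :=
    tendsto_nhdsWithin_iff.2 ⟨tendsto_pi_nhds.2 hh, Eventually.of_forall fun n => Or.inr ⟨n, rfl⟩⟩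
  simpa only [hμ.map_zero, Function.comp_def] using (hcont 0 (Set.mem_insert _ _)).tendsto.comp ht

end UniformMeasureLemmas

lemma Semiuniform.isUb_section {X Y : Type*} [UniformSpace X] [UniformSpace Y] {f : X × Y → ℝ}
    (hf : Semiuniform f) (x : X) : IsUb fun y => f (x, y) :=
  ⟨hf.2.2 x, hf.1.imp fun _ hC y => hC (x, y)⟩

lemma Semiuniform.uniformEquicontinuous_integral {ι X Y : Type*} [UniformSpace X] [UniformSpace Y]
    {f : X × Y → ℝ} (hf : Semiuniform f) {ν : ι → (Y → ℝ) → ℝ} (hν : ∀ i, IsMeas (ν i)) {C : ℝ}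
    (hC0 : 0 ≤ C) (hC : ∀ i (g : Y → ℝ) (r : ℝ), 0 < r → IsUb g → (∀ y, |g y| ≤ r) →
      |ν i g| ≤ C * r) :
    UniformEquicontinuous fun i x => ν i fun y => f (x, y) := by
  have he := hf.2.1
  rw [uniformEquicontinuous_real_iff] at he ⊢
  intro ε hε
  filter_upwards [he (ε / (C + 1)) (by positivity)] with p hp i
  have hub := (hf.isUb_section p.1).sub (hf.isUb_section p.2)
  rw [← (hν i).map_sub (hf.isUb_section p.2) hub]
  refine (hC i _ (ε / (C + 1)) (by positivity) hub fun y => (hp y).le).trans_lt ?_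
  rw [← mul_div_assoc, div_lt_iff₀ (by positivity)]
  linarith

theorem stmt5 {X Y : Type*} [UniformSpace X] [UniformSpace Y]
    (μn : ℕ → (X → ℝ) → ℝ) (νn : ℕ → (Y → ℝ) → ℝ)
    (μ : (X → ℝ) → ℝ) (ν : (Y → ℝ) → ℝ)
    (hμn : ∀ n, IsMeas (μn n) ∧ IsUniformMeasure (μn n))
    (hνn : ∀ n, IsMeas (νn n) ∧ IsUniformMeasure (νn n))
    (hμ : IsMeas μ ∧ IsUniformMeasure μ) (hν : IsMeas ν ∧ IsUniformMeasure ν)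
    (hμconv : ∀ g : X → ℝ, IsUb g → Tendsto (fun n => μn n g) atTop (𝓝 (μ g)))
    (hνconv : ∀ h : Y → ℝ, IsUb h → Tendsto (fun n => νn n h) atTop (𝓝 (ν h)))
    (f : X × Y → ℝ) (hf : Semiuniform f) :
    Tendsto (fun n => dirProd (μn n) (νn n) f) atTop (𝓝 (dirProd μ ν f)) := by
  obtain ⟨C, hC0, hC⟩ := exists_uniform_bound_of_tendsto (fun n => (hνn n).1) hνconv
  obtain ⟨D, hD⟩ := hf.1
  have hD' : ∀ p, |f p| ≤ |D| + 1 := fun p => (hD p).trans (by linarith [le_abs_self D])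
  have hDpos : 0 < |D| + 1 := by positivity
  have hbν : ∀ (g : Y → ℝ) (r : ℝ), 0 < r → IsUb g → (∀ y, |g y| ≤ r) → |ν g| ≤ C * r :=
    fun g r hr hg hgr => le_of_tendsto (hνconv g hg).abs
      (Eventually.of_forall fun n => hC n g r hr hg hgr)
  have hen := hf.uniformEquicontinuous_integral (fun n => (hνn n).1) hC0 hC
  have heν := hf.uniformEquicontinuous_integral (ι := Unit) (fun _ => hν.1) hC0 fun _ => hbν
  have hbn : ∀ n x, |νn n fun y => f (x, y)| ≤ C * (|D| + 1) := fun n x =>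
    hC n _ _ hDpos (hf.isUb_section x) fun y => hD' (x, y)
  have hb : ∀ x, |ν fun y => f (x, y)| ≤ C * (|D| + 1) := fun x =>
    hbν _ _ hDpos (hf.isUb_section x) fun y => hD' (x, y)
  set G : X → ℝ := fun x => ν fun y => f (x, y) with hG
  set Gn : ℕ → X → ℝ := fun n x => νn n fun y => f (x, y) with hGn
  have hGub : IsUb G := ⟨heν.uniformContinuous (), _, hb⟩
  have hGnub : ∀ n, IsUb (Gn n) := fun n => ⟨hen.uniformContinuous n, _, hbn n⟩
  have hed : UniformEquicontinuous fun n => Gn n - G := by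
    rw [uniformEquicontinuous_real_iff] at hen heν ⊢
    intro ε hε
    filter_upwards [hen (ε / 2) (by positivity), heν (ε / 2) (by positivity)] with p h1 h2 n
    have e : (Gn n - G) p.1 - (Gn n - G) p.2 = (Gn n p.1 - Gn n p.2) - (G p.1 - G p.2) := by
      simp only [Pi.sub_apply]; ring
    rw [e]
    exact (abs_sub _ _).trans_lt (by linarith [h1 n, h2 ()])
  have hbd : ∀ n x, |(Gn n - G) x| ≤ C * (|D| + 1) + C * (|D| + 1) := fun n x =>
    (abs_sub _ _).trans (add_le_add (hbn n x) (hb x))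
  have hpt : ∀ x, Tendsto (fun n => (Gn n - G) x) atTop (𝓝 0) := fun x => by
    simpa [hG] using (hνconv _ (hf.isUb_section x)).sub_const (G x)
  have hB0 : 0 ≤ C * (|D| + 1) + C * (|D| + 1) := by positivity
  have hdiag := tendsto_diag (σ := fun n g => μn n g - μ g) (fun n => (hμn n).1.sub hμ.1)
    (fun n H hb he => ((hμn n).2.continuousOn hb he).sub (hμ.2.continuousOn hb he))
    (fun g hg => by simpa using (hμconv g hg).sub_const (μ g)) hed hB0 hbd hpt
  have hfix := hμ.2.tendsto_zero hμ.1 hed hB0 hbd hpt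
  have hsum := (hdiag.add hfix).add (hμconv G hGub)
  rw [zero_add, zero_add] at hsum
  refine hsum.congr fun n => ?_
  change μn n (Gn n - G) - μ (Gn n - G) + μ (Gn n - G) + μn n G = μn n (Gn n)
  rw [(hμn n).1.map_sub hGub ((hGnub n).sub hGub)]
  ring
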